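/- Let K be a field, κ an infinite cardinal, R = R(κ,K), and let λ be an infinite cardinal with λ ≤ κ. Let M_λ be the R-submodule of K^κ consisting of all f : κ → K whose support has cardinality < λ. Then M_λ is not λ⁺-injective: there exist an ideal I of R generated by λ elements (namely the ideal of all finitely supported functions with support contained in a fixed subset of κ of cardinality λ) and an R-linear map φ : I → M_λ (the inclusion) that does not extend to an R-linear map R → M_λ. -/

import Mathlib

/-- The `K`-subalgebra `R(κ,K)` of `K^κ` consisting of all eventually constant functions:
all `f : ι → K` such that for some `c ∈ K`, `f a = c` for all but finitely many `a`. -/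
def Rconst (K ι : Type*) [Field K] : Subalgebra K (ι → K) where
  carrier := {f | ∃ c : K, {a | f a ≠ c}.Finite}
  mul_mem' := by
    rintro f g ⟨c, hc⟩ ⟨d, hd⟩
    refine ⟨c * d, (hc.union hd).subset fun a ha => ?_⟩
    by_contra h
    simp only [Set.mem_union, Set.mem_setOf_eq, not_or, not_not] at h
    exact ha (show (f * g) a = _ by rw [Pi.mul_apply, h.1, h.2])
  add_mem' := by
    rintro f g ⟨c, hc⟩ ⟨d, hd⟩
    refine ⟨c + d, (hc.union hd).subset fun a ha => ?_⟩
    by_contra h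
    simp only [Set.mem_union, Set.mem_setOf_eq, not_or, not_not] at h
    exact ha (show (f + g) a = _ by rw [Pi.add_apply, h.1, h.2])
  algebraMap_mem' := fun c => ⟨c, by simp [Set.finite_empty]⟩

set_option synthInstance.maxHeartbeats 1000000 in
set_option maxHeartbeats 2000000 in
/-- The `R(κ,K)`-submodule `M_λ` of `K^κ` consisting of all functions whose support has
cardinality `< λ`. -/
def Mlam (K ι : Type u) [Field K] (lam : Cardinal.{u}) (hlam : Cardinal.aleph0 ≤ lam) :
    Submodule (Rconst K ι) (ι → K) where
  carrier := {f | Cardinal.mk {a | f a ≠ 0} < lam}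
  add_mem' := by
    intro f g hf hg
    refine lt_of_le_of_lt ?_ (Cardinal.add_lt_of_lt hlam hf hg)
    refine le_trans (Cardinal.mk_le_mk_of_subset fun a ha => ?_) (Cardinal.mk_union_le _ _)
    by_contra h
    simp only [Set.mem_union, Set.mem_setOf_eq, not_or, not_not] at h
    exact ha (show (f + g) a = 0 by rw [Pi.add_apply, h.1, h.2, add_zero])
  zero_mem' := by
    have he : {a : ι | (0 : ι → K) a ≠ 0} = ∅ := by simp
    show Cardinal.mk {a : ι | (0 : ι → K) a ≠ 0} < lam
    rw [he]
    simpa using lt_of_lt_of_le Cardinal.aleph0_pos hlam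
  smul_mem' := by
    intro c f hf
    refine lt_of_le_of_lt (Cardinal.mk_le_mk_of_subset fun a ha => ?_) hf
    by_contra h
    simp only [Set.mem_setOf_eq, not_not] at h
    exact ha (show (c • f) a = 0 by
      show (c : ι → K) a * f a = 0
      rw [h, mul_zero])

open Classical in
/-- The indicator function of the point `a`, as an element of `R(κ,K)`. -/
noncomputable def Rconst.single (K : Type*) {ι : Type*} [Field K] (a : ι) : Rconst K ι :=
  ⟨Pi.single a 1, 0, (Set.finite_singleton a).subset fun b hb => by
    by_contra h
    exact hb (Pi.single_eq_of_ne h 1)⟩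

theorem Rconst.single_apply_self (K : Type*) {ι : Type*} [Field K] (a : ι) :
    (Rconst.single K a : ι → K) a = 1 := by
  simp [Rconst.single]

theorem Rconst.single_apply_of_ne (K : Type*) {ι : Type*} [Field K] {a b : ι} (h : b ≠ a) :
    (Rconst.single K a : ι → K) b = 0 := by
  simp [Rconst.single, h]

/-- The inclusion of `R(κ,K)` into `K^κ`, as an `R(κ,K)`-linear map. -/
def Rconst.inclusion (K ι : Type*) [Field K] : Rconst K ι →ₗ[Rconst K ι] (ι → K) where
  toFun x := x
  map_add' _ _ := rfl
  map_smul' _ _ := rfl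

theorem Rconst.single_mem_Mlam (K : Type u) {ι : Type u} [Field K] (lam : Cardinal.{u})
    (hlam : Cardinal.aleph0 ≤ lam) (a : ι) :
    Rconst.inclusion K ι (Rconst.single K a) ∈ Mlam K ι lam hlam := by
  have hsub : {b | (Rconst.single K a : ι → K) b ≠ 0} ⊆ {a} := fun b hb => by
    by_contra h
    exact hb (Rconst.single_apply_of_ne K h)
  exact ((Set.finite_singleton a).subset hsub).lt_aleph0.trans_le hlam


set_option synthInstance.maxHeartbeats 1000000 in
set_option maxHeartbeats 2000000 in
/-- Let `K` be a field, `κ = #ι` for an infinite index type `ι`,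
`R = R(κ,K)`, and `λ` an infinite cardinal with `λ ≤ κ`. Then `M_λ` is not `λ⁺`-injective:
there are an ideal `I` of `R` generated by `λ` elements and an `R`-homomorphism
`φ : I → M_λ` that does not extend to an `R`-homomorphism `R → M_λ`. -/
theorem Mlam_not_lambda_succ_injective
    (K ι : Type u) [Field K] [Infinite ι]
    (lam : Cardinal.{u}) (hlam : Cardinal.aleph0 ≤ lam)
    (hle : lam ≤ Cardinal.mk ι) :
    ∃ (I : Ideal (Rconst K ι)) (φ : I →ₗ[Rconst K ι] Mlam K ι lam hlam),
      (∃ S : Set (Rconst K ι), Cardinal.mk S ≤ lam ∧ Ideal.span S = I) ∧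
        ¬ ∃ ψ : Rconst K ι →ₗ[Rconst K ι] Mlam K ι lam hlam,
            ∀ (x : Rconst K ι) (hx : x ∈ I), ψ x = φ ⟨x, hx⟩ := by
  obtain ⟨A, hA⟩ := Cardinal.le_mk_iff_exists_set.mp hle
  have hI : ∀ x ∈ Ideal.span (Rconst.single K '' A),
      Rconst.inclusion K ι x ∈ Mlam K ι lam hlam := by
    have h : Ideal.span (Rconst.single K '' A) ≤
        (Mlam K ι lam hlam).comap (Rconst.inclusion K ι) := by
      refine Ideal.span_le.mpr ?_
      rintro _ ⟨a, -, rfl⟩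
      exact Rconst.single_mem_Mlam K lam hlam a
    exact fun x hx => h hx
  refine ⟨Ideal.span (Rconst.single K '' A), (Rconst.inclusion K ι).restrict hI,
    ⟨_, Cardinal.mk_image_le.trans hA.le, rfl⟩, ?_⟩
  rintro ⟨ψ, hψ⟩
  have hsub : A ⊆ {a | (ψ 1 : ι → K) a ≠ 0} := fun a ha h0 => by
    have h1 := hψ (Rconst.single K a) (Ideal.subset_span ⟨a, ha, rfl⟩)
    have h2 : ψ (Rconst.single K a) = Rconst.single K a • ψ 1 := by
      rw [← map_smul, smul_eq_mul, mul_one]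
    have h3 : (Rconst.single K a : ι → K) a * (ψ 1 : ι → K) a =
        (Rconst.single K a : ι → K) a :=
      congrArg (fun m : Mlam K ι lam hlam => (m : ι → K) a) (h2.symm.trans h1)
    rw [h0, mul_zero, Rconst.single_apply_self] at h3
    exact zero_ne_one h3
  have hlt : Cardinal.mk {a | (ψ 1 : ι → K) a ≠ 0} < lam := (ψ 1).2
  exact absurd (hA.symm.le.trans (Cardinal.mk_le_mk_of_subset hsub)) hlt.not_ge
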